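/- Let K be an algebraically closed field, V a nonzero finite-dimensional K-vector space, G a group, and ρ : G → GL(V) a representation such that V is irreducible (i.e. simple as a module under the G-action induced by ρ). Let n ≥ 1, let Γ be a cyclic group of order n, and let φ : Γ → Aut(G) be an action of Γ on G by group automorphisms. Assume that for every γ ∈ Γ the twisted representation g ↦ ρ(φ(γ)(g)) is isomorphic to ρ, i.e. there exists a K-linear automorphism T of V with T ∘ ρ(g) = ρ(φ(γ)(g)) ∘ T for all g ∈ G. Then ρ extends to the semidirect product: there exists a group homomorphism ρ̂ : Γ ⋉_φ G → GL(V) whose restriction to the normal subgroup G equals ρ. -/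

import Mathlib

/-- Schur's lemma for an irreducible set of operators: a linear endomorphism commuting with
an irreducible family of operators over an algebraically closed field is a scalar. -/
theorem Module.End.exists_eq_smul_one_of_commute {K V ι : Type*} [Field K] [IsAlgClosed K]
    [AddCommGroup V] [Module K V] [FiniteDimensional K V] [Nontrivial V]
    (r : ι → Module.End K V)
    (hirr : ∀ W : Submodule K V, (∀ i, ∀ v ∈ W, r i v ∈ W) → W = ⊥ ∨ W = ⊤)
    (f : Module.End K V) (hf : ∀ i, Commute f (r i)) :
    ∃ c : K, f = c • 1 := by
  obtain ⟨c, hc⟩ := Module.End.exists_eigenvalue f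
  refine ⟨c, ?_⟩
  have htop : f.eigenspace c = ⊤ := by
    refine (hirr _ fun i v hv => ?_).resolve_left hc
    rw [Module.End.mem_eigenspace_iff] at hv ⊢
    rw [← Module.End.mul_apply, (hf i).eq, Module.End.mul_apply, hv, map_smul]
  ext v
  have hv : v ∈ f.eigenspace c := htop ▸ Submodule.mem_top
  simpa using Module.End.mem_eigenspace_iff.mp hv

/-- A homomorphism `f : G →* H` extends to `G ⋊[φ] Γ` with `Γ` cyclic generated by `γ` as soon as
the twist of `f` by `γ` is conjugation by an element whose order divides that of `γ`. -/
theorem SemidirectProduct.exists_comp_inl_eq_of_zpowers {G Γ H : Type*} [Group G] [Group Γ]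
    [Group H] (φ : Γ →* MulAut G) (f : G →* H) {γ : Γ}
    (hγ : ∀ x : Γ, x ∈ Subgroup.zpowers γ) {T : H}
    (hT : ∀ g, T * f g * T⁻¹ = f (φ γ g)) (hord : orderOf T ∣ orderOf γ) :
    ∃ F : (G ⋊[φ] Γ) →* H, F.comp SemidirectProduct.inl = f := by
  let t : Γ →* H := monoidHomOfForallMemZpowers hγ hord
  have htγ : t γ = T := monoidHomOfForallMemZpowers_apply_gen hγ hord
  let S : Subgroup Γ :=
    { carrier := {x | ∀ g, t x * f g * (t x)⁻¹ = f (φ x g)}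
      one_mem' := fun g => by simp
      mul_mem' := fun {x y} hx hy g => by
        rw [map_mul φ, MulAut.mul_apply, ← hx, ← hy, map_mul]
        group
      inv_mem' := fun {x} hx g => by
        have h := hx (φ x⁻¹ g)
        rw [← MulAut.mul_apply, ← map_mul, mul_inv_cancel, map_one, MulAut.one_apply] at h
        rw [← h, map_inv]
        group }
  have hS (x : Γ) : x ∈ S :=
    Subgroup.zpowers_le.mpr (show γ ∈ S from fun g => by rw [htγ, hT]) (hγ x)
  refine ⟨SemidirectProduct.lift f t fun x => ?_, SemidirectProduct.lift_comp_inl _ _ _⟩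
  ext g
  exact (hS x g).symm

/-- An irreducible representation of `G` on a nonzero finite-dimensional vector space over an
algebraically closed field extends to the semidirect product `G ⋊[φ] Γ` with a finite cyclic
group `Γ` of order `n ≥ 1`, provided each `γ`-twist of `ρ` is isomorphic to `ρ`. -/
theorem extend_irreducible_rep_to_semidirectProduct
    (K : Type*) [Field K] [IsAlgClosed K]
    (V : Type*) [AddCommGroup V] [Module K V] [FiniteDimensional K V] [Nontrivial V]
    (G : Type*) [Group G]
    (ρ : G →* LinearMap.GeneralLinearGroup K V)
    (hirr : ∀ W : Submodule K V, (∀ g : G, ∀ v ∈ W, (ρ g).val v ∈ W) → W = ⊥ ∨ W = ⊤)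
    (n : ℕ) (hn : 1 ≤ n)
    (Γ : Type*) [Group Γ] [Fintype Γ] [IsCyclic Γ] (hΓ : Fintype.card Γ = n)
    (φ : Γ →* MulAut G)
    (htwist : ∀ γ : Γ, ∃ T : LinearMap.GeneralLinearGroup K V,
      ∀ g : G, T.val ∘ₗ (ρ g).val = (ρ (φ γ g)).val ∘ₗ T.val) :
    ∃ ρhat : (G ⋊[φ] Γ) →* LinearMap.GeneralLinearGroup K V,
      ρhat.comp SemidirectProduct.inl = ρ := by
  obtain ⟨γ, hγ⟩ := IsCyclic.exists_generator (α := Γ)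
  have hγn : orderOf γ = n := by
    rw [orderOf_eq_card_of_forall_mem_zpowers hγ, Nat.card_eq_fintype_card, hΓ]
  obtain ⟨T, hT⟩ := htwist γ
  have hconj (g : G) : T * ρ g * T⁻¹ = ρ (φ γ g) :=
    mul_inv_eq_of_eq_mul (Units.ext (hT g))
  have hpow (k : ℕ) (g : G) : T ^ k * ρ g = ρ (φ (γ ^ k) g) * T ^ k := by
    induction k generalizing g with
    | zero => simp
    | succ k ih =>
      rw [pow_succ, mul_assoc, mul_inv_eq_iff_eq_mul.mp (hconj g), ← mul_assoc, ih, mul_assoc,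
        pow_succ, map_mul, MulAut.mul_apply]
  have hcomm (g : G) : Commute (T ^ n) (ρ g) := by
    have h := hpow n g
    rwa [← hγn, pow_orderOf_eq_one, map_one, MulAut.one_apply, hγn] at h
  obtain ⟨c, hc⟩ := Module.End.exists_eq_smul_one_of_commute (fun g => (ρ g).val) hirr
    (T ^ n).val fun g => (hcomm g).map (Units.coeHom _)
  have hc0 : c ≠ 0 := by
    rintro rfl
    exact (T ^ n).ne_zero (by rw [hc, zero_smul])
  obtain ⟨d, hd⟩ := IsAlgClosed.exists_pow_nat_eq c hn
  have hd0 : d ≠ 0 := by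
    rintro rfl
    exact hc0 (by rw [← hd, zero_pow (by omega)])
  let D : LinearMap.GeneralLinearGroup K V :=
    Units.map (algebraMap K (Module.End K V)).toMonoidHom (Units.mk0 d hd0)
  have hD (A : LinearMap.GeneralLinearGroup K V) : Commute D A :=
    Units.ext (Algebra.commutes d A.val)
  have hDn : D ^ n = T ^ n := by
    ext1
    rw [hc, ← hd, ← Algebra.algebraMap_eq_smul_one, map_pow, Units.val_pow_eq_pow_val]
    rfl
  refine SemidirectProduct.exists_comp_inl_eq_of_zpowers φ ρ hγ (T := D⁻¹ * T) (fun g => ?_) ?_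
  · rw [← hconj g, mul_inv_rev, inv_inv, mul_assoc D⁻¹, mul_assoc D⁻¹, ← mul_assoc _ T⁻¹,
      ← (hD _).eq, inv_mul_cancel_left]
  · rw [hγn]
    apply orderOf_dvd_of_pow_eq_one
    rw [(hD T).inv_left.mul_pow, inv_pow, hDn, inv_mul_cancel]
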